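/- For every K > 0 there exists a positive constant C₂, depending only on K, with the following property: for every 1-periodic C² function F : ℝ³ → ℝ with ‖F‖_{C²} ≤ K and ∫_{[0,1]³} e^F dV = 1, and every u ∈ C̃⁴(T³) solving the reduced Calabi–Yau equation (u_xx + 1)(u_yy + u_tt + u_t + 1) − u_xy² − u_xt² = e^F, one has |u|_{C¹} ≤ C₂, i.e. sup|u_x|, sup|u_y|, sup|u_t| ≤ C₂. -/

import Mathlib

open MeasureTheory

noncomputable section

/-- Points of `ℝ³`, written as `ℝ × ℝ × ℝ`. -/
abbrev R3 := ℝ × ℝ × ℝ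

/-- The coordinate direction `x`. -/
def vx : R3 := (1, 0, 0)
/-- The coordinate direction `y`. -/
def vy : R3 := (0, 1, 0)
/-- The coordinate direction `t`. -/
def vt : R3 := (0, 0, 1)

/-- Partial (directional) derivative in the direction `e`. -/
def pd (e : R3) (u : R3 → ℝ) : R3 → ℝ := fun p => fderiv ℝ u p e

/-- `1`-periodicity in each of the three variables. -/
def Periodic3 (u : R3 → ℝ) : Prop :=
  ∀ p : R3, u (p + vx) = u p ∧ u (p + vy) = u p ∧ u (p + vt) = u p

/-- The unit cube `[0,1]³`. -/
def cube : Set R3 := Set.Icc (0, 0, 0) (1, 1, 1)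

/-- Zero mean over the unit cube. -/
def ZeroMean (u : R3 → ℝ) : Prop := ∫ p in cube, u p = 0

/-- The reduced Calabi–Yau equation
`(u_xx + 1)(u_yy + u_tt + u_t + 1) − u_xy² − u_xt² = e^F` on `ℝ³`. -/
def CYeq (F u : R3 → ℝ) : Prop :=
  ∀ p : R3,
    (pd vx (pd vx u) p + 1)
        * (pd vy (pd vy u) p + pd vt (pd vt u) p + pd vt u p + 1)
      - (pd vy (pd vx u) p) ^ 2 - (pd vt (pd vx u) p) ^ 2 = Real.exp (F p)

/-- The Euclidean norm on `ℝ³ = ℝ × ℝ × ℝ`. -/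
def enorm3 (h : R3) : ℝ := Real.sqrt (h.1 ^ 2 + h.2.1 ^ 2 + h.2.2 ^ 2)

/-- `‖F‖_{C²} ≤ K`: all partial derivatives of `F` of order `≤ 2` are bounded by `K`. -/
def C2Bound (F : R3 → ℝ) (K : ℝ) : Prop :=
  ∀ p : R3, |F p| ≤ K ∧
    (∀ e ∈ ({vx, vy, vt} : Set R3), |pd e F p| ≤ K) ∧
    (∀ e ∈ ({vx, vy, vt} : Set R3), ∀ e' ∈ ({vx, vy, vt} : Set R3),
      |pd e (pd e' F) p| ≤ K)

theorem symbol_trace_nonpos {A B D w1 w2 P11 P12 P13 P22 P23 P33 : ℝ} (hA : 0 < A) (hD : 0 < D)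
    (hdet : A * B - w1 ^ 2 - w2 ^ 2 = D)
    (hP : ∀ a b c : ℝ, a ^ 2 * P11 + b ^ 2 * P22 + c ^ 2 * P33
      + 2 * (a * b * P12 + a * c * P13 + b * c * P23) ≤ 0) :
    B * P11 + A * (P22 + P33) - 2 * w1 * P12 - 2 * w2 * P13 ≤ 0 := by
  have h1 := hP (-w1) A 0
  have h2 := hP (-w2) 0 A
  have h3 := mul_nonpos_of_nonneg_of_nonpos hD.le (hP 1 0 0)
  have key : A * (B * P11 + A * (P22 + P33) - 2 * w1 * P12 - 2 * w2 * P13) ≤ 0 := by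
    subst hdet
    linarith
  exact nonpos_of_mul_nonpos_right key hA

theorem symbol_coercive {A B D w1 w2 : ℝ} (hdet : A * B - w1 ^ 2 - w2 ^ 2 = D) (a b c : ℝ) :
    D * (a ^ 2 + b ^ 2 + c ^ 2)
      ≤ (A + B) * (B * a ^ 2 + A * (b ^ 2 + c ^ 2) - 2 * a * (w1 * b + w2 * c)) := by
  subst hdet
  nlinarith [sq_nonneg (B * a - (w1 * b + w2 * c)), sq_nonneg (A * b - a * w1),
    sq_nonneg (A * c - a * w2), sq_nonneg (w1 * c - w2 * b)]

theorem sq_frobenius_ge_of_eigenvector {g1 g2 g3 H11 H12 H13 H22 H23 H33 μ : ℝ}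
    (hg : 0 < g1 ^ 2 + g2 ^ 2 + g3 ^ 2)
    (h1 : g1 * H11 + g2 * H12 + g3 * H13 = μ * g1)
    (h2 : g1 * H12 + g2 * H22 + g3 * H23 = μ * g2)
    (h3 : g1 * H13 + g2 * H23 + g3 * H33 = μ * g3) :
    μ ^ 2 ≤ (H11 ^ 2 + H12 ^ 2 + H13 ^ 2) + (H12 ^ 2 + H22 ^ 2 + H23 ^ 2)
      + (H13 ^ 2 + H23 ^ 2 + H33 ^ 2) := by
  have cs : ∀ a b c : ℝ, (g1 * a + g2 * b + g3 * c) ^ 2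
      ≤ (g1 ^ 2 + g2 ^ 2 + g3 ^ 2) * (a ^ 2 + b ^ 2 + c ^ 2) := fun a b c => by
    nlinarith [sq_nonneg (g1 * b - g2 * a), sq_nonneg (g1 * c - g3 * a),
      sq_nonneg (g2 * c - g3 * b)]
  have e1 := cs H11 H12 H13
  have e2 := cs H12 H22 H23
  have e3 := cs H13 H23 H33
  rw [h1] at e1
  rw [h2] at e2
  rw [h3] at e3
  refine le_of_mul_le_mul_left ?_ hg
  linarith

theorem max_principle_inequality
    {g1 g2 g3 H11 H12 H13 H22 H23 H33 T111 T112 T113 T122 T123 T133 T222 T223 T233 T333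
      f1 f2 f3 A B D κ : ℝ}
    (hA : 0 < A) (hD : 0 < D) (hAH : A = H11 + 1) (hBH : B = H22 + H33 + g3 + 1)
    (hdet : A * B - H12 ^ 2 - H13 ^ 2 = D)
    (hc3 : 2 * (g1 * H13 + g2 * H23 + g3 * H33) - κ * g3 = 0)
    (hd1 : T111 * B + A * (T122 + T133 + H13) - 2 * H12 * T112 - 2 * H13 * T113 = D * f1)
    (hd2 : T112 * B + A * (T222 + T233 + H23) - 2 * H12 * T122 - 2 * H13 * T123 = D * f2)
    (hd3 : T113 * B + A * (T223 + T333 + H33) - 2 * H12 * T123 - 2 * H13 * T133 = D * f3)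
    (hP : ∀ a b c : ℝ,
      a ^ 2 * (2 * (H11 * H11 + g1 * T111 + (H12 * H12 + g2 * T112)
          + (H13 * H13 + g3 * T113)) - κ * H11)
        + b ^ 2 * (2 * (H12 * H12 + g1 * T122 + (H22 * H22 + g2 * T222)
          + (H23 * H23 + g3 * T223)) - κ * H22)
        + c ^ 2 * (2 * (H13 * H13 + g1 * T133 + (H23 * H23 + g2 * T233)
          + (H33 * H33 + g3 * T333)) - κ * H33)
        + 2 * (a * b * (2 * (H12 * H11 + g1 * T112 + (H22 * H12 + g2 * T122)
            + (H23 * H13 + g3 * T123)) - κ * H12)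
          + a * c * (2 * (H13 * H11 + g1 * T113 + (H23 * H12 + g2 * T123)
            + (H33 * H13 + g3 * T133)) - κ * H13)
          + b * c * (2 * (H13 * H12 + g1 * T123 + (H23 * H22 + g2 * T223)
            + (H33 * H23 + g3 * T233)) - κ * H23)) ≤ 0) :
    2 * ((B * H11 ^ 2 + A * (H12 ^ 2 + H13 ^ 2) - 2 * H11 * (H12 * H12 + H13 * H13))
      + (B * H12 ^ 2 + A * (H22 ^ 2 + H23 ^ 2) - 2 * H12 * (H12 * H22 + H13 * H23))
      + (B * H13 ^ 2 + A * (H23 ^ 2 + H33 ^ 2) - 2 * H13 * (H12 * H23 + H13 * H33)))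
      + 2 * D * (g1 * f1 + g2 * f2 + g3 * f3) - 2 * κ * D + κ * (A + B) ≤ 0 := by
  have h := symbol_trace_nonpos hA hD hdet hP
  refine le_of_eq_of_le ?_ h
  linear_combination (-2 * g1) * hd1 - 2 * g2 * hd2 - 2 * g3 * hd3 + A * hc3 + 2 * κ * hdet
    - κ * B * hAH - κ * A * hBH

theorem gradient_bound_of_max
    {g1 g2 g3 H11 H12 H13 H22 H23 H33 f1 f2 f3 A B D K N L : ℝ}
    (hA : 0 < A) (hD : 0 < D) (hDL : D ≤ L) (hK : 0 ≤ K) (hN : 0 < N)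
    (hdet : A * B - H12 ^ 2 - H13 ^ 2 = D)
    (hg : 0 < g1 ^ 2 + g2 ^ 2 + g3 ^ 2) (hgN : g1 ^ 2 + g2 ^ 2 + g3 ^ 2 ≤ N ^ 2)
    (hf1 : |f1| ≤ K) (hf2 : |f2| ≤ K) (hf3 : |f3| ≤ K)
    (hc1 : 2 * (g1 * H11 + g2 * H12 + g3 * H13) - N / 6 * g1 = 0)
    (hc2 : 2 * (g1 * H12 + g2 * H22 + g3 * H23) - N / 6 * g2 = 0)
    (hc3 : 2 * (g1 * H13 + g2 * H23 + g3 * H33) - N / 6 * g3 = 0)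
    (hmax : 2 * ((B * H11 ^ 2 + A * (H12 ^ 2 + H13 ^ 2) - 2 * H11 * (H12 * H12 + H13 * H13))
      + (B * H12 ^ 2 + A * (H22 ^ 2 + H23 ^ 2) - 2 * H12 * (H12 * H22 + H13 * H23))
      + (B * H13 ^ 2 + A * (H23 ^ 2 + H33 ^ 2) - 2 * H13 * (H12 * H23 + H13 * H33)))
      + 2 * D * (g1 * f1 + g2 * f2 + g3 * f3) - 2 * (N / 6) * D + N / 6 * (A + B) ≤ 0) :
    N ≤ 72 * (L * (2 + 36 * K)) * (1 / 3 + 6 * K) := by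
  have hB : 0 < B := by
    have : 0 < A * B := by nlinarith [sq_nonneg H12, sq_nonneg H13]
    exact pos_of_mul_pos_right this hA.le
  have c1 := symbol_coercive hdet H11 H12 H13
  have c2 := symbol_coercive hdet H12 H22 H23
  have c3 := symbol_coercive hdet H13 H23 H33
  set q := (B * H11 ^ 2 + A * (H12 ^ 2 + H13 ^ 2) - 2 * H11 * (H12 * H12 + H13 * H13))
      + (B * H12 ^ 2 + A * (H22 ^ 2 + H23 ^ 2) - 2 * H12 * (H12 * H22 + H13 * H23))
      + (B * H13 ^ 2 + A * (H23 ^ 2 + H33 ^ 2) - 2 * H13 * (H12 * H23 + H13 * H33)) with hq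
  have hfrob := sq_frobenius_ge_of_eigenvector (μ := N / 12)
    (H11 := H11) (H12 := H12) (H13 := H13) (H22 := H22) (H23 := H23) (H33 := H33) hg
    (by linarith) (by linarith) (by linarith)
  have hS : 0 < A + B := by positivity
  have hqS : D * (N / 12) ^ 2 ≤ (A + B) * q := by
    have := mul_le_mul_of_nonneg_left hfrob hD.le
    rw [hq]
    linarith
  have hq0 : 0 < q := by
    have : 0 < (A + B) * q := lt_of_lt_of_le (by positivity) hqS
    exact pos_of_mul_pos_right this hS.le
  have hterm : ∀ g f : ℝ, g ^ 2 ≤ N ^ 2 → |f| ≤ K → -(N * K) ≤ g * f := fun g f h1 h2 => by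
    have h3 : |g| ≤ N := abs_le_of_sq_le_sq h1 hN.le
    have h4 : |g * f| ≤ N * K := by
      rw [abs_mul]
      gcongr
    exact neg_le_of_abs_le h4
  have t1 := hterm g1 f1 (by linarith [sq_nonneg g2, sq_nonneg g3]) hf1
  have t2 := hterm g2 f2 (by linarith [sq_nonneg g1, sq_nonneg g3]) hf2
  have t3 := hterm g3 f3 (by linarith [sq_nonneg g1, sq_nonneg g2]) hf3
  have hgf : -(3 * (N * K)) * D ≤ (g1 * f1 + g2 * f2 + g3 * f3) * D :=
    mul_le_mul_of_nonneg_right (by linarith) hD.le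
  have hSb : A + B ≤ D * (2 + 36 * K) := by
    refine le_of_mul_le_mul_left ?_ hN
    linarith
  have hqb : q ≤ N * D * (1 / 6 + 3 * K) := by
    have : 0 < N / 6 * (A + B) := by positivity
    linarith
  have h1 : D * (N / 12) ^ 2 ≤ (A + B) * (N * D * (1 / 6 + 3 * K)) :=
    hqS.trans (mul_le_mul_of_nonneg_left hqb hS.le)
  have h2 : N ≤ 72 * (A + B) * (1 / 3 + 6 * K) := by
    refine le_of_mul_le_mul_left ?_ (mul_pos hN hD)
    linarith
  have h3 : A + B ≤ L * (2 + 36 * K) :=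
    hSb.trans (mul_le_mul_of_nonneg_right hDL (by positivity))
  refine h2.trans ?_
  gcongr

theorem pd_hasDerivAt {f : R3 → ℝ} (hf : Differentiable ℝ f) (e p : R3) (s : ℝ) :
    HasDerivAt (fun s : ℝ => f (p + s • e)) (pd e f (p + s • e)) s := by
  have h1 : HasDerivAt (fun s : ℝ => p + s • e) e s := by
    simpa using ((hasDerivAt_id s).smul_const e).const_add p
  exact (hf (p + s • e)).hasFDerivAt.comp_hasDerivAt s h1

theorem pd_contDiff {f : R3 → ℝ} {n m : WithTop ℕ∞} (hf : ContDiff ℝ n f) (h : m + 1 ≤ n)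
    (e : R3) : ContDiff ℝ m (pd e f) :=
  (hf.fderiv_right h).clm_apply contDiff_const

theorem pd_comm {f : R3 → ℝ} (hf : ContDiff ℝ 2 f) (a b : R3) :
    pd a (pd b f) = pd b (pd a f) := by
  have h1 : Differentiable ℝ (fderiv ℝ f) :=
    (hf.fderiv_right (m := 1) (by norm_num)).differentiable (by norm_num)
  have key : ∀ a b p : R3, fderiv ℝ (fun q => fderiv ℝ f q b) p a
      = fderiv ℝ (fderiv ℝ f) p a b := fun a b p => by
    rw [fderiv_clm_apply (h1 p) (differentiableAt_const b)]
    simp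
  funext p
  have hs : IsSymmSndFDerivAt ℝ f p := hf.contDiffAt.isSymmSndFDerivAt (by simp)
  exact (key a b p).trans ((hs a b).trans (key b a p).symm)

theorem pd_add {f g : R3 → ℝ} (hf : Differentiable ℝ f) (hg : Differentiable ℝ g) (e : R3) :
    pd e (fun q => f q + g q) = fun q => pd e f q + pd e g q := by
  funext p
  simp [pd, fderiv_fun_add (hf p) (hg p)]

theorem pd_const_mul {f : R3 → ℝ} (hf : Differentiable ℝ f) (c : ℝ) (e : R3) :
    pd e (fun q => c * f q) = fun q => c * pd e f q := by
  funext p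
  simp [pd, fderiv_const_mul (hf p) c]

theorem pd_neg (f : R3 → ℝ) (e : R3) : pd e (fun q => -f q) = fun q => -pd e f q := by
  funext p
  simp [pd, fderiv_fun_neg]

theorem pd_direction (f : R3 → ℝ) (a b c : ℝ) :
    pd (a, b, c) f = fun q => a * pd vx f q + b * pd vy f q + c * pd vt f q := by
  funext p
  have h : ((a, b, c) : R3) = a • vx + b • vy + c • vt := by simp [vx, vy, vt]
  simp only [pd]
  rw [h]
  simp

theorem pd_eq_zero_of_forall_le {f : R3 → ℝ} {p : R3} (h : ∀ q, f q ≤ f p) (e : R3) :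
    pd e f p = 0 := by
  have : IsLocalMax f p := Filter.Eventually.of_forall h
  simp [pd, this.fderiv_eq_zero]

theorem pd_pd_nonpos_of_forall_le {f : R3 → ℝ} (hf : ContDiff ℝ 2 f) {p : R3}
    (h : ∀ q, f q ≤ f p) (e : R3) : pd e (pd e f) p ≤ 0 := by
  by_contra! hpos
  have d1 := pd_hasDerivAt (hf.differentiable (by norm_num)) e p
  have d2 := pd_hasDerivAt ((pd_contDiff (m := 1) hf (by norm_num) e).differentiable
    (by norm_num)) e p
  set φ : ℝ → ℝ := fun s => f (p + s • e) with hφ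
  have hφ1 : deriv φ = fun s => pd e f (p + s • e) := funext fun s => (d1 s).deriv
  have hφ2 : deriv (deriv φ) 0 = pd e (pd e f) p := by
    rw [hφ1, (d2 0).deriv]
    simp
  have hφ0 : deriv φ 0 = 0 := by
    rw [hφ1]
    simpa using pd_eq_zero_of_forall_le h e
  have hmin := isLocalMin_of_deriv_deriv_pos (hφ2 ▸ hpos) hφ0 (d1 0).continuousAt
  have hconst : φ =ᶠ[nhds 0] fun _ => f p := by
    filter_upwards [hmin] with s hs
    exact le_antisymm (h _) (by simpa [hφ] using hs)
  have : deriv (deriv φ) 0 = 0 := by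
    rw [hconst.deriv.deriv_eq]
    simp
  linarith

theorem hessian_nonpos_of_forall_le {f : R3 → ℝ} (hf : ContDiff ℝ 2 f) {p : R3}
    (h : ∀ q, f q ≤ f p) (a b c : ℝ) :
    a ^ 2 * pd vx (pd vx f) p + b ^ 2 * pd vy (pd vy f) p + c ^ 2 * pd vt (pd vt f) p
      + 2 * (a * b * pd vy (pd vx f) p + a * c * pd vt (pd vx f) p
        + b * c * pd vt (pd vy f) p) ≤ 0 := by
  have hd : ∀ e, Differentiable ℝ (pd e f) := fun e =>
    (pd_contDiff (m := 1) hf (by norm_num) e).differentiable (by norm_num)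
  have key := pd_pd_nonpos_of_forall_le hf h (a, b, c)
  have e1 : ∀ e, pd e (pd (a, b, c) f) p
      = a * pd e (pd vx f) p + b * pd e (pd vy f) p + c * pd e (pd vt f) p := fun e => by
    rw [pd_direction f, pd_add (f := fun q => a * pd vx f q + b * pd vy f q)
      (((hd vx).const_mul a).add ((hd vy).const_mul b)) ((hd vt).const_mul c), pd_add
      ((hd vx).const_mul a) ((hd vy).const_mul b),
      pd_const_mul (hd vx), pd_const_mul (hd vy), pd_const_mul (hd vt)]
  rw [pd_direction (pd (a, b, c) f)] at key
  simp only [e1] at key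
  rw [pd_comm hf vx vy, pd_comm hf vx vt, pd_comm hf vy vt] at key
  linarith

theorem Periodic3.partialDeriv {f : R3 → ℝ} (hf : Periodic3 f) (e : R3) : Periodic3 (pd e f) := by
  have key : ∀ v : R3, (∀ p, f (p + v) = f p) → ∀ p, fderiv ℝ f (p + v) e = fderiv ℝ f p e :=
    fun v hv p => by
      rw [← fderiv_comp_add_right v, funext hv]
  exact fun p => ⟨key vx (fun q => (hf q).1) p, key vy (fun q => (hf q).2.1) p,
    key vt (fun q => (hf q).2.2) p⟩

theorem Periodic3.exists_mem_cube {f : R3 → ℝ} (hf : Periodic3 f) (p : R3) :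
    ∃ q ∈ cube, f q = f p := by
  obtain ⟨x, y, t⟩ := p
  have h1 : Function.Periodic (fun s => f (s, Int.fract y, Int.fract t)) 1 := fun s => by
    simpa [vx] using (hf (s, Int.fract y, Int.fract t)).1
  have h2 : Function.Periodic (fun s => f (x, s, Int.fract t)) 1 := fun s => by
    simpa [vy] using (hf (x, s, Int.fract t)).2.1
  have h3 : Function.Periodic (fun s => f (x, y, s)) 1 := fun s => by
    simpa [vt] using (hf (x, y, s)).2.2
  have e1 := h1.sub_int_mul_eq (x := x) ⌊x⌋
  have e2 := h2.sub_int_mul_eq (x := y) ⌊y⌋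
  have e3 := h3.sub_int_mul_eq (x := t) ⌊t⌋
  simp only [mul_one, Int.self_sub_floor] at e1 e2 e3
  refine ⟨(Int.fract x, Int.fract y, Int.fract t), ⟨?_, ?_⟩, e1.trans (e2.trans e3)⟩
  · exact ⟨Int.fract_nonneg x, Int.fract_nonneg y, Int.fract_nonneg t⟩
  · exact ⟨(Int.fract_lt_one x).le, (Int.fract_lt_one y).le, (Int.fract_lt_one t).le⟩

theorem Periodic3.exists_forall_le {f : R3 → ℝ} (hf : Periodic3 f) (hc : Continuous f) :
    ∃ p, ∀ q, f q ≤ f p := by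
  obtain ⟨p, -, hp⟩ := (isCompact_Icc : IsCompact cube).exists_isMaxOn
    ⟨((0, 0, 0) : R3), by simp [Prod.le_def]⟩ hc.continuousOn
  refine ⟨p, fun q => ?_⟩
  obtain ⟨r, hr, hrq⟩ := hf.exists_mem_cube q
  exact hrq ▸ hp hr

theorem Periodic3.osc_le {f : R3 → ℝ} (hf : Periodic3 f) (hd : Differentiable ℝ f) {N : ℝ}
    (hx : ∀ p, |pd vx f p| ≤ N) (hy : ∀ p, |pd vy f p| ≤ N) (ht : ∀ p, |pd vt f p| ≤ N)
    (p q : R3) : f p - f q ≤ 3 * N := by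
  have hN : 0 ≤ N := (abs_nonneg _).trans (hx 0)
  obtain ⟨a, ha, hap⟩ := hf.exists_mem_cube p
  obtain ⟨b, hb, hbq⟩ := hf.exists_mem_cube q
  have hbound : ∀ r ∈ cube, ‖fderiv ℝ f r‖ ≤ 3 * N := fun r _ => by
    refine ContinuousLinearMap.opNorm_le_bound _ (by positivity) fun v => ?_
    obtain ⟨v1, v2, v3⟩ := v
    have h := congrFun (pd_direction f v1 v2 v3) r
    simp only [pd] at h hx hy ht
    rw [h]
    have hv1 : |v1| ≤ ‖((v1, v2, v3) : R3)‖ := by simp [Prod.norm_def]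
    have hv2 : |v2| ≤ ‖((v1, v2, v3) : R3)‖ := by simp [Prod.norm_def]
    have hv3 : |v3| ≤ ‖((v1, v2, v3) : R3)‖ := by simp [Prod.norm_def]
    set V := ‖((v1, v2, v3) : R3)‖
    have m1 : |v1 * fderiv ℝ f r vx| ≤ V * N := by
      rw [abs_mul]; exact mul_le_mul hv1 (hx r) (abs_nonneg _) (norm_nonneg _)
    have m2 : |v2 * fderiv ℝ f r vy| ≤ V * N := by
      rw [abs_mul]; exact mul_le_mul hv2 (hy r) (abs_nonneg _) (norm_nonneg _)
    have m3 : |v3 * fderiv ℝ f r vt| ≤ V * N := by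
      rw [abs_mul]; exact mul_le_mul hv3 (ht r) (abs_nonneg _) (norm_nonneg _)
    rw [Real.norm_eq_abs]
    linarith [abs_add_three (v1 * fderiv ℝ f r vx) (v2 * fderiv ℝ f r vy)
      (v3 * fderiv ℝ f r vt)]
  have hmv := (convex_Icc _ _ : Convex ℝ cube).norm_image_sub_le_of_norm_fderiv_le
    (fun r _ => hd r) hbound hb ha
  have hab : ‖a - b‖ ≤ 1 := by
    obtain ⟨a1, a2, a3⟩ := a
    obtain ⟨b1, b2, b3⟩ := b
    simp only [cube, Set.mem_Icc, Prod.mk_le_mk] at ha hb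
    simp only [Prod.mk_sub_mk, Prod.norm_def, Real.norm_eq_abs, sup_le_iff, abs_le]
    refine ⟨⟨?_, ?_⟩, ⟨?_, ?_⟩, ?_, ?_⟩ <;> linarith [ha.1.1, ha.1.2.1, ha.1.2.2, ha.2.1,
      ha.2.2.1, ha.2.2.2, hb.1.1, hb.1.2.1, hb.1.2.2, hb.2.1, hb.2.2.1, hb.2.2.2]
  rw [← hap, ← hbq]
  calc f a - f b ≤ ‖f a - f b‖ := le_abs_self _
    _ ≤ 3 * N * ‖a - b‖ := hmv
    _ ≤ 3 * N := mul_le_of_le_one_right (by positivity) hab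

theorem CYeq.uxx_add_one_pos {F u : R3 → ℝ} (hu : ContDiff ℝ 2 u) (hper : Periodic3 u)
    (heq : CYeq F u) (p : R3) : 0 < pd vx (pd vx u) p + 1 := by
  have hne : ∀ q, pd vx (pd vx u) q + 1 ≠ 0 := fun q h0 => by
    have h := heq q
    rw [h0, zero_mul] at h
    nlinarith [Real.exp_pos (F q), sq_nonneg (pd vy (pd vx u) q), sq_nonneg (pd vt (pd vx u) q)]
  have hc : Continuous fun q => pd vx (pd vx u) q + 1 :=
    (pd_contDiff (m := 0) (pd_contDiff (m := 1) hu (by norm_num) vx)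
      (by norm_num) vx).continuous.add continuous_const
  have hnper : Periodic3 fun q => -u q := fun q => by
    simp [(hper q).1, (hper q).2.1, (hper q).2.2]
  obtain ⟨m, hm⟩ := hnper.exists_forall_le hu.continuous.neg
  have hmpos : 0 < pd vx (pd vx u) m + 1 := by
    have h := pd_pd_nonpos_of_forall_le hu.neg hm vx
    rw [pd_neg, pd_neg] at h
    linarith
  by_contra! hp
  obtain ⟨r, -, hr⟩ := isPreconnected_univ.intermediate_value (Set.mem_univ p)
    (Set.mem_univ m) hc.continuousOn ⟨hp, hmpos.le⟩
  exact hne r hr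

theorem pd_CYeq {a b c d w1 w2 F : R3 → ℝ} (ha : Differentiable ℝ a) (hb : Differentiable ℝ b)
    (hc : Differentiable ℝ c) (hd : Differentiable ℝ d) (hw1 : Differentiable ℝ w1)
    (hw2 : Differentiable ℝ w2) (hF : Differentiable ℝ F)
    (h : ∀ q, (a q + 1) * (b q + c q + d q + 1) - w1 q ^ 2 - w2 q ^ 2 = Real.exp (F q))
    (e p : R3) :
    pd e a p * (b p + c p + d p + 1) + (a p + 1) * (pd e b p + pd e c p + pd e d p)
      - 2 * w1 p * pd e w1 p - 2 * w2 p * pd e w2 p = Real.exp (F p) * pd e F p := by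
  have line : ∀ {f : R3 → ℝ}, Differentiable ℝ f →
      HasDerivAt (fun s : ℝ => f (p + s • e)) (pd e f p) 0 := fun hf => by
    simpa using pd_hasDerivAt hf e p 0
  have h1 := ((((line ha).add_const 1).mul
    ((((line hb).add (line hc)).add (line hd)).add_const 1)).sub ((line hw1).pow 2)).sub
    ((line hw2).pow 2)
  have h2 := (line hF).exp
  have h3 := h1.unique (h2.congr_of_eventuallyEq (Filter.Eventually.of_forall fun s => by
    simpa using h (p + s • e)))
  simp only [zero_smul, add_zero, Pi.add_apply] at h3
  rw [← h3]
  push_cast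
  ring

theorem pd_sq_grad_sub {g1 g2 g3 u : R3 → ℝ} (h1 : Differentiable ℝ g1)
    (h2 : Differentiable ℝ g2) (h3 : Differentiable ℝ g3) (hu : Differentiable ℝ u) (κ : ℝ)
    (e : R3) :
    pd e (fun q => g1 q ^ 2 + g2 q ^ 2 + g3 q ^ 2 - κ * u q)
      = fun q => 2 * (g1 q * pd e g1 q + g2 q * pd e g2 q + g3 q * pd e g3 q)
        - κ * pd e u q := by
  funext p
  have line : ∀ {f : R3 → ℝ}, Differentiable ℝ f →
      HasDerivAt (fun s : ℝ => f (p + s • e)) (pd e f p) 0 := fun hf => by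
    simpa using pd_hasDerivAt hf e p 0
  have l := line (((h1.pow 2).add (h2.pow 2)).add (h3.pow 2) |>.sub (hu.const_mul κ))
  have r := ((((line h1).pow 2).add ((line h2).pow 2)).add ((line h3).pow 2)).sub
    ((line hu).const_mul κ)
  refine (l.unique r).trans ?_
  simp only [zero_smul, add_zero]
  push_cast
  ring

theorem pd_pd_sq_grad_sub {g1 g2 g3 u : R3 → ℝ} (h1 : ContDiff ℝ 2 g1)
    (h2 : ContDiff ℝ 2 g2) (h3 : ContDiff ℝ 2 g3) (hu : ContDiff ℝ 2 u) (κ : ℝ) (a e p : R3) :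
    pd a (pd e (fun q => g1 q ^ 2 + g2 q ^ 2 + g3 q ^ 2 - κ * u q)) p
      = 2 * (pd a g1 p * pd e g1 p + g1 p * pd a (pd e g1) p
        + (pd a g2 p * pd e g2 p + g2 p * pd a (pd e g2) p)
        + (pd a g3 p * pd e g3 p + g3 p * pd a (pd e g3) p)) - κ * pd a (pd e u) p := by
  have hd : ∀ {f : R3 → ℝ}, ContDiff ℝ 2 f → Differentiable ℝ f :=
    fun hf => hf.differentiable (by norm_num)
  rw [pd_sq_grad_sub (hd h1) (hd h2) (hd h3) (hd hu)]
  have line : ∀ {f : R3 → ℝ}, Differentiable ℝ f →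
      HasDerivAt (fun s : ℝ => f (p + s • a)) (pd a f p) 0 := fun hf => by
    simpa using pd_hasDerivAt hf a p 0
  have hd' : ∀ {f : R3 → ℝ}, ContDiff ℝ 2 f → Differentiable ℝ (pd e f) :=
    fun hf => (pd_contDiff (m := 1) hf (by norm_num) e).differentiable (by norm_num)
  have l := line ((((hd h1).mul (hd' h1)).add ((hd h2).mul (hd' h2))).add
    ((hd h3).mul (hd' h3)) |>.const_mul 2 |>.sub ((hd' hu).const_mul κ))
  have r := (((((line (hd h1)).mul (line (hd' h1))).add ((line (hd h2)).mul (line (hd' h2)))).add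
    ((line (hd h3)).mul (line (hd' h3)))).const_mul 2).sub ((line (hd' hu)).const_mul κ)
  refine (l.unique r).trans ?_
  simp only [zero_smul, add_zero]

/-- The Bernstein method: the maximum principle is applied to `|∇u|² - (N / 6) u`, where
`N = max |∇u|`. -/
theorem CYeq.sq_grad_le {F u : R3 → ℝ} {K : ℝ} (hK : 0 ≤ K) (hF : ContDiff ℝ 2 F)
    (hFK : C2Bound F K) (hu : ContDiff ℝ 4 u) (hper : Periodic3 u) (heq : CYeq F u) :
    ∃ N : ℝ, N ≤ 72 * (Real.exp K * (2 + 36 * K)) * (1 / 3 + 6 * K) ∧ 0 ≤ N ∧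
      ∀ q, pd vx u q ^ 2 + pd vy u q ^ 2 + pd vt u q ^ 2 ≤ N ^ 2 := by
  have hu2 : ContDiff ℝ 2 u := hu.of_le (by norm_num)
  have hu1 : ∀ e, ContDiff ℝ 2 (pd e u) := fun e =>
    (pd_contDiff (m := 3) hu (by norm_num) e).of_le (by norm_num)
  have hd : ∀ {f : R3 → ℝ}, ContDiff ℝ 2 f → Differentiable ℝ f :=
    fun hf => hf.differentiable (by norm_num)
  have hd2 : ∀ a b, Differentiable ℝ (pd a (pd b u)) := fun a b =>
    (pd_contDiff (m := 1) (hu1 b) (by norm_num) a).differentiable (by norm_num)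
  have gper := fun e => hper.partialDeriv e
  have hβper : Periodic3 fun q => pd vx u q ^ 2 + pd vy u q ^ 2 + pd vt u q ^ 2 := fun q => by
    simp [(gper _ q).1, (gper _ q).2.1, (gper _ q).2.2]
  obtain ⟨m, hm⟩ := hβper.exists_forall_le (by
    have := fun e => (hu1 e).continuous
    fun_prop)
  set N := Real.sqrt (pd vx u m ^ 2 + pd vy u m ^ 2 + pd vt u m ^ 2)
  have hNsq : N ^ 2 = pd vx u m ^ 2 + pd vy u m ^ 2 + pd vt u m ^ 2 :=
    Real.sq_sqrt (by positivity)
  have hβN : ∀ q, pd vx u q ^ 2 + pd vy u q ^ 2 + pd vt u q ^ 2 ≤ N ^ 2 := fun q =>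
    hNsq ▸ hm q
  have hN0 : 0 ≤ N := Real.sqrt_nonneg _
  refine ⟨N, ?_, hN0, hβN⟩
  rcases hN0.eq_or_lt with h0 | hNpos
  · rw [← h0]
    positivity
  have hsq : ∀ q, 0 ≤ pd vx u q ^ 2 ∧ 0 ≤ pd vy u q ^ 2 ∧ 0 ≤ pd vt u q ^ 2 := fun q =>
    ⟨sq_nonneg _, sq_nonneg _, sq_nonneg _⟩
  have hosc := hper.osc_le (hd hu2) (N := N)
    (fun q => abs_le_of_sq_le_sq (by linarith [hβN q, (hsq q).1, (hsq q).2.1, (hsq q).2.2]) hN0)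
    (fun q => abs_le_of_sq_le_sq (by linarith [hβN q, (hsq q).1, (hsq q).2.1, (hsq q).2.2]) hN0)
    (fun q => abs_le_of_sq_le_sq (by linarith [hβN q, (hsq q).1, (hsq q).2.1, (hsq q).2.2]) hN0)
  have hΨ : ContDiff ℝ 2 fun q =>
      pd vx u q ^ 2 + pd vy u q ^ 2 + pd vt u q ^ 2 - N / 6 * u q :=
    ((((hu1 vx).pow 2).add ((hu1 vy).pow 2)).add ((hu1 vt).pow 2)).sub (contDiff_const.mul hu2)
  have hΨper : Periodic3 fun q =>
      pd vx u q ^ 2 + pd vy u q ^ 2 + pd vt u q ^ 2 - N / 6 * u q := fun q => by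
    simp [(gper _ q).1, (gper _ q).2.1, (gper _ q).2.2, (hper q).1, (hper q).2.1, (hper q).2.2]
  obtain ⟨p, hp⟩ := hΨper.exists_forall_le hΨ.continuous
  have hgrad : 0 < pd vx u p ^ 2 + pd vy u p ^ 2 + pd vt u p ^ 2 := by
    have h1 := hp m
    have h2 := mul_le_mul_of_nonneg_left (hosc m p) hN0
    have h3 : 0 < N ^ 2 := by positivity
    simp only [← hNsq] at h1
    nlinarith
  have hcrit := fun e => pd_eq_zero_of_forall_le hp e
  simp only [pd_sq_grad_sub (hd (hu1 vx)) (hd (hu1 vy)) (hd (hu1 vt)) (hd hu2)] at hcrit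
  have hhess := hessian_nonpos_of_forall_le hΨ hp
  simp only [pd_pd_sq_grad_sub (hu1 vx) (hu1 vy) (hu1 vt) hu2] at hhess
  have hderiv := fun e => pd_CYeq (hd2 vx vx) (hd2 vy vy) (hd2 vt vt) (hd (hu1 vt)) (hd2 vy vx)
    (hd2 vt vx) (hd hF) heq e p
  have hxy := pd_comm hu2 vx vy
  have hxt := pd_comm hu2 vx vt
  have hyt := pd_comm hu2 vy vt
  have hxy' := fun e => pd_comm (hu1 e) vx vy
  have hxt' := fun e => pd_comm (hu1 e) vx vt
  have hyt' := fun e => pd_comm (hu1 e) vy vt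
  have hcx := hcrit vx
  have hcy := hcrit vy
  have hct := hcrit vt
  have hdx := hderiv vx
  have hdy := hderiv vy
  have hdt := hderiv vt
  simp only [hxy, hxt, hyt, hxy', hxt', hyt'] at hcx hcy hct hdx hdy hdt hhess
  have hA := heq.uxx_add_one_pos hu2 hper p
  have hD := Real.exp_pos (F p)
  obtain ⟨hF0, hF1, -⟩ := hFK p
  have hmax := max_principle_inequality hA hD rfl rfl (heq p) hct hdx hdy hdt hhess
  exact gradient_bound_of_max hA hD (Real.exp_le_exp.mpr (abs_le.mp hF0).2) hK hNpos (heq p)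
    hgrad (hβN p) (hF1 vx (by simp)) (hF1 vy (by simp)) (hF1 vt (by simp)) hcx hcy hct hmax

/-- Gradient estimate: for every `K > 0` there is `C₂ > 0`,
depending only on `K`, bounding all first derivatives of every `C⁴` solution `u`
of the reduced Calabi–Yau equation with `‖F‖_{C²} ≤ K` and `∫ e^F = 1`. -/
theorem stmt12 (K : ℝ) (hK : 0 < K) :
    ∃ C₂ : ℝ, 0 < C₂ ∧
      ∀ F u : R3 → ℝ,
        ContDiff ℝ 2 F → Periodic3 F → C2Bound F K →
        (∫ p in cube, Real.exp (F p)) = 1 →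
        ContDiff ℝ 4 u → Periodic3 u → ZeroMean u → CYeq F u →
        ∀ e ∈ ({vx, vy, vt} : Set R3), ∀ p : R3, |pd e u p| ≤ C₂ := by
  refine ⟨72 * (Real.exp K * (2 + 36 * K)) * (1 / 3 + 6 * K), by positivity, ?_⟩
  intro F u hF _ hFK _ hu hper _ heq e he p
  obtain ⟨N, hNC, hN0, hN⟩ := heq.sq_grad_le hK.le hF hFK hu hper
  refine (abs_le_of_sq_le_sq ?_ hN0).trans hNC
  have h := hN p
  have hx := sq_nonneg (pd vx u p)
  have hy := sq_nonneg (pd vy u p)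
  have ht := sq_nonneg (pd vt u p)
  simp only [Set.mem_insert_iff, Set.mem_singleton_iff] at he
  rcases he with rfl | rfl | rfl <;> linarith

end
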